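/- arXiv:2212.14375 — 4 statements merged into one kernel-verified Lean document; each statement's English description precedes it below -/
import Mathlib

section
/- Let G be a finite multigraph with tail and head maps t, h : E → V. To a closed walk in G associate its incidence vector in ℤ^E, assigning to each edge the number of times it is traversed forwards (tail to head) minus the number of times it is traversed backwards. Then the kernel of the boundary map ∂ : ℤ^E → ℤ^V is generated, as an abelian group, by the incidence vectors of closed walks of G. -/
/-- The starting vertex of a step `(e, dir)`. -/
def stepStart {V E : Type*} (t hd : E → V) (st : E × Bool) : V :=
  if st.2 then t st.1 else hd st.1

/-- The ending vertex of a step `(e, dir)`. -/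
def stepEnd {V E : Type*} (t hd : E → V) (st : E × Bool) : V :=
  if st.2 then hd st.1 else t st.1

/-- `IsWalk t hd v w l` : the list of steps `l` forms a walk from `v` to `w`. -/
def IsWalk {V E : Type*} (t hd : E → V) : V → V → List (E × Bool) → Prop
  | v, w, [] => v = w
  | v, w, st :: l => stepStart t hd st = v ∧ IsWalk t hd (stepEnd t hd st) w l

/-- The boundary map `∂ : ℤ^E → ℤ^V`. -/
def boundary {V E : Type*} [Fintype E] [DecidableEq V] (t hd : E → V)
    (c : E → ℤ) : V → ℤ :=
  fun v => (∑ e, if hd e = v then c e else 0) - (∑ e, if t e = v then c e else 0)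

/-- The incidence vector of a walk: each edge gets the number of times it is
traversed forwards minus the number of times it is traversed backwards. -/
def incidenceVector {E : Type*} [DecidableEq E] (l : List (E × Bool)) : E → ℤ :=
  fun e => (l.map fun st => if st.1 = e then (if st.2 then (1 : ℤ) else -1) else 0).sum

section Walks

variable {V E : Type*} {t hd : E → V}

theorem IsWalk.append {u v w : V} {l m : List (E × Bool)}
    (hl : IsWalk t hd u v l) (hm : IsWalk t hd v w m) : IsWalk t hd u w (l ++ m) := by
  induction l generalizing u with
  | nil => obtain rfl : u = v := hl; exact hm
  | cons st l ih => exact ⟨hl.1, ih hl.2⟩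

/-- The steps of a walk traversed in the opposite direction. -/
def reverseSteps (l : List (E × Bool)) : List (E × Bool) :=
  (l.map fun st => (st.1, !st.2)).reverse

theorem reverseSteps_cons (st : E × Bool) (l : List (E × Bool)) :
    reverseSteps (st :: l) = reverseSteps l ++ [(st.1, !st.2)] := by
  simp [reverseSteps]

theorem IsWalk.reverse {u v : V} {l : List (E × Bool)} (hl : IsWalk t hd u v l) :
    IsWalk t hd v u (reverseSteps l) := by
  induction l generalizing u with
  | nil => exact Eq.symm hl
  | cons st l ih =>
    rw [reverseSteps_cons]
    refine (ih hl.2).append ⟨?_, ?_⟩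
    · rcases st with ⟨e, _ | _⟩ <;> rfl
    · rw [← hl.1]
      rcases st with ⟨e, _ | _⟩ <;> rfl

variable (t hd) in
/-- Two vertices are equivalent when a walk joins them. -/
def walkSetoid : Setoid V where
  r u v := ∃ l, IsWalk t hd u v l
  iseqv :=
    { refl := fun _ => ⟨[], rfl⟩
      symm := fun ⟨_, hl⟩ => ⟨_, hl.reverse⟩
      trans := fun ⟨_, hl⟩ ⟨_, hm⟩ => ⟨_, hl.append hm⟩ }

section Incidence

variable [DecidableEq E]

theorem incidenceVector_nil : incidenceVector ([] : List (E × Bool)) = 0 := rfl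

theorem incidenceVector_append (l m : List (E × Bool)) :
    incidenceVector (l ++ m) = incidenceVector l + incidenceVector m := by
  funext e
  simp [incidenceVector]

theorem incidenceVector_singleton (st : E × Bool) :
    incidenceVector [st] = Pi.single st.1 (if st.2 then 1 else -1) := by
  funext e
  simp [incidenceVector, Pi.single_apply, eq_comm (a := e)]

theorem incidenceVector_cons (st : E × Bool) (l : List (E × Bool)) :
    incidenceVector (st :: l) = incidenceVector [st] + incidenceVector l :=
  incidenceVector_append [st] l

theorem incidenceVector_reverseSteps (l : List (E × Bool)) :
    incidenceVector (reverseSteps l) = -incidenceVector l := by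
  induction l with
  | nil => rfl
  | cons st l ih =>
    rw [reverseSteps_cons, incidenceVector_append, ih, incidenceVector_cons st l, neg_add_rev]
    congr 1
    rw [incidenceVector_singleton, incidenceVector_singleton, ← Pi.single_neg]
    rcases st with ⟨e, _ | _⟩ <;> simp

end Incidence

section Boundary

variable [Fintype E] [DecidableEq V]

theorem boundary_add (c d : E → ℤ) :
    boundary t hd (c + d) = boundary t hd c + boundary t hd d := by
  funext v
  simp only [boundary, Pi.add_apply, ← Finset.sum_filter, Finset.sum_add_distrib]
  ring

/-- Summation by parts: a vector in the kernel of the boundary map pairs to zero with the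
coboundary of any function on the vertices. -/
theorem sum_smul_head_eq_sum_smul_tail {A : Type*} [AddCommGroup A] {c : E → ℤ}
    (hc : boundary t hd c = 0) (f : V → A) :
    ∑ e, c e • f (hd e) = ∑ e, c e • f (t e) := by
  have fiberwise (g : E → V) (S : Finset V) (hS : ∀ e, g e ∈ S) :
      ∑ e, c e • f (g e) = ∑ v ∈ S, (∑ e, if g e = v then c e else 0) • f v := by
    simp_rw [Finset.sum_smul, ite_smul, zero_smul]
    rw [Finset.sum_comm]
    refine Finset.sum_congr rfl fun e _ => ?_
    rw [Finset.sum_ite_eq, if_pos (hS e)]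
  let S := Finset.univ.image hd ∪ Finset.univ.image t
  rw [fiberwise hd S (by simp [S]), fiberwise t S (by simp [S])]
  refine Finset.sum_congr rfl fun v _ => ?_
  rw [sub_eq_zero.mp (congrFun hc v)]

variable [DecidableEq E]

theorem boundary_incidenceVector_singleton (st : E × Bool) :
    boundary t hd (incidenceVector [st]) =
      Pi.single (stepEnd t hd st) 1 - Pi.single (stepStart t hd st) 1 := by
  have sum_single (g : E → V) (e₀ : E) (a : ℤ) (v : V) :
      (∑ e, if g e = v then (Pi.single e₀ a : E → ℤ) e else 0) =
        if v = g e₀ then a else 0 := by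
    rw [Finset.sum_eq_single e₀ (fun e _ he => by simp [Pi.single_eq_of_ne he]) (by simp)]
    simp [eq_comm]
  funext v
  rw [incidenceVector_singleton, boundary, sum_single, sum_single]
  rcases st with ⟨e, _ | _⟩ <;> simp only [stepStart, stepEnd, Pi.sub_apply, Pi.single_apply] <;>
    split_ifs <;> simp_all

theorem IsWalk.boundary_incidenceVector {u v : V} {l : List (E × Bool)}
    (hl : IsWalk t hd u v l) :
    boundary t hd (incidenceVector l) = Pi.single v 1 - Pi.single u 1 := by
  induction l generalizing u with
  | nil =>
    obtain rfl : u = v := hl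
    funext w
    simp [incidenceVector_nil, boundary]
  | cons st l ih =>
    rw [incidenceVector_cons, boundary_add, ih hl.2, boundary_incidenceVector_singleton, hl.1]
    abel

/-- Choosing a base point in every component and a walk from it to every vertex closes up each
edge to a closed walk, and the extra contributions cancel on the kernel of the boundary map. -/
theorem mem_closure_closed_walks_of_boundary_eq_zero {c : E → ℤ} (hc : boundary t hd c = 0) :
    c ∈ AddSubgroup.closure
      {c : E → ℤ | ∃ (v : V) (l : List (E × Bool)),
        IsWalk t hd v v l ∧ c = incidenceVector l} := by
  let base (v : V) : V := (Quotient.mk (walkSetoid t hd) v).out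
  have exists_walk (v : V) : ∃ l, IsWalk t hd (base v) v l :=
    Quotient.mk_out (s := walkSetoid t hd) v
  choose p hp using exists_walk
  have base_eq (e : E) : base (hd e) = base (t e) :=
    congrArg Quotient.out
      (Quotient.sound (s := walkSetoid t hd) ⟨[(e, false)], rfl, rfl⟩)
  let loop (e : E) := p (t e) ++ ([(e, true)] ++ reverseSteps (p (hd e)))
  have loop_isWalk (e : E) : IsWalk t hd (base (t e)) (base (t e)) (loop e) := by
    have edge_isWalk : IsWalk t hd (t e) (hd e) [(e, true)] := ⟨rfl, rfl⟩
    exact (hp (t e)).append (edge_isWalk.append (base_eq e ▸ (hp (hd e)).reverse))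
  have incidence_loop (e : E) : incidenceVector (loop e) =
      incidenceVector (p (t e)) + (Pi.single e 1 - incidenceVector (p (hd e))) := by
    simp only [loop, incidenceVector_append, incidenceVector_reverseSteps,
      incidenceVector_singleton, sub_eq_add_neg, if_true]
  have c_eq : c = ∑ e, c e • incidenceVector (loop e) := by
    simp only [incidence_loop, smul_add, smul_sub, Finset.sum_add_distrib, Finset.sum_sub_distrib]
    rw [sum_smul_head_eq_sum_smul_tail hc fun v => incidenceVector (p v), add_sub_cancel]
    exact pi_eq_sum_univ' c
  rw [c_eq]
  refine sum_mem fun e _ => zsmul_mem (AddSubgroup.subset_closure ?_) _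
  exact ⟨_, _, loop_isWalk e, rfl⟩

end Boundary

end Walks

/-- The kernel of the boundary map `∂ : ℤ^E → ℤ^V` of a finite multigraph is
generated, as an abelian group, by the incidence vectors of closed walks. -/
theorem ker_boundary_generated_by_closed_walks
    {V E : Type*} [Fintype E] [DecidableEq V] [DecidableEq E] (t hd : E → V) :
    ∀ c : E → ℤ,
      c ∈ AddSubgroup.closure
          {c : E → ℤ | ∃ (v : V) (l : List (E × Bool)),
            IsWalk t hd v v l ∧ c = incidenceVector l} ↔
        boundary t hd c = 0 := by
  refine fun c => ⟨fun hc => ?_, mem_closure_closed_walks_of_boundary_eq_zero⟩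
  have closure_le_ker : AddSubgroup.closure
      {c : E → ℤ | ∃ (v : V) (l : List (E × Bool)),
        IsWalk t hd v v l ∧ c = incidenceVector l} ≤
      (AddMonoidHom.mk' (boundary t hd) boundary_add).ker := by
    rw [AddSubgroup.closure_le]
    rintro _ ⟨v, l, hl, rfl⟩
    exact hl.boundary_incidenceVector.trans (sub_self _)
  exact closure_le_ker hc
end

section
/- Let A be an abelian group and M ⊆ A a submonoid with M ∩ (−M) = {0} (a sharp monoid). Let G be a finite multigraph with tail and head maps t, h : E → V, let ℓ : E → M \ {0} be a length function with nonzero lengths, let s : E → ℤ, and suppose there exists α : V → A with α(h(e)) − α(t(e)) = s(e)·ℓ(e) for every edge e. Then the flow s is acyclic: G has no closed s-ascending walk. -/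
/-- An `s`-ascending walk from `v` to `w`: every edge traversed forwards has
`s e ≥ 0`, every edge traversed backwards has `s e ≤ 0`, and at least one of
these inequalities is strict. -/
def Ascending {V E : Type*} (t hd : E → V) (s : E → ℤ) (v w : V)
    (l : List (E × Bool)) : Prop :=
  IsWalk t hd v w l ∧
    (∀ st ∈ l, (st.2 = true → 0 ≤ s st.1) ∧ (st.2 = false → s st.1 ≤ 0)) ∧
    (∃ st ∈ l, (st.2 = true ∧ 0 < s st.1) ∨ (st.2 = false ∧ s st.1 < 0))

theorem zsmul_mem_of_nonneg {A : Type*} [AddCommGroup A] {M : AddSubmonoid A} {x : A}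
    (hx : x ∈ M) {n : ℤ} (hn : 0 ≤ n) : n • x ∈ M := by
  lift n to ℕ using hn
  rw [natCast_zsmul]
  exact M.nsmul_mem hx n

/-- A piecewise linear function changes by `|s e| • ℓ e` along a step that is ascending in the
weak sense. -/
theorem sub_eq_abs_slope_zsmul {V E A : Type*} [AddCommGroup A] {t hd : E → V} {ℓ : E → A}
    {s : E → ℤ} {α : V → A} (hα : ∀ e : E, α (hd e) - α (t e) = s e • ℓ e) {st : E × Bool}
    (hst : (st.2 = true → 0 ≤ s st.1) ∧ (st.2 = false → s st.1 ≤ 0)) :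
    α (stepEnd t hd st) - α (stepStart t hd st) = |s st.1| • ℓ st.1 := by
  obtain ⟨e, _ | _⟩ := st
  · have h : s e ≤ 0 := hst.2 rfl
    simp [stepStart, stepEnd, abs_of_nonpos h, ← hα e]
  · have h : 0 ≤ s e := hst.1 rfl
    simp [stepStart, stepEnd, abs_of_nonneg h, ← hα e]

/-- A piecewise linear function increases by an element of the monoid along a walk that is
ascending in the weak sense. -/
theorem IsWalk.sub_mem {V E A : Type*} [AddCommGroup A] {M : AddSubmonoid A} {t hd : E → V}
    {ℓ : E → A} (hℓ : ∀ e : E, ℓ e ∈ M) {s : E → ℤ} {α : V → A}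
    (hα : ∀ e : E, α (hd e) - α (t e) = s e • ℓ e) {v w : V} {l : List (E × Bool)}
    (hl : IsWalk t hd v w l)
    (hs : ∀ st ∈ l, (st.2 = true → 0 ≤ s st.1) ∧ (st.2 = false → s st.1 ≤ 0)) :
    α w - α v ∈ M := by
  induction l generalizing v with
  | nil =>
    obtain rfl : v = w := hl
    simp
  | cons st l ih =>
    obtain ⟨rfl, hl⟩ := hl
    rw [List.forall_mem_cons] at hs
    rw [← sub_add_sub_cancel _ (α (stepEnd t hd st)), sub_eq_abs_slope_zsmul hα hs.1]
    exact M.add_mem (ih hl hs.2) (zsmul_mem_of_nonneg (hℓ _) (abs_nonneg _))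

/-- Along an ascending walk, a piecewise linear function increases by at least the length of
some edge. -/
theorem Ascending.exists_sub_sub_length_mem {V E A : Type*} [AddCommGroup A]
    {M : AddSubmonoid A} {t hd : E → V} {ℓ : E → A} (hℓ : ∀ e : E, ℓ e ∈ M) {s : E → ℤ}
    {α : V → A} (hα : ∀ e : E, α (hd e) - α (t e) = s e • ℓ e) {v w : V}
    {l : List (E × Bool)} (hl : Ascending t hd s v w l) :
    ∃ e : E, α w - α v - ℓ e ∈ M := by
  obtain ⟨hw, hs, hstrict⟩ := hl
  induction l generalizing v with
  | nil => simp at hstrict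
  | cons st l ih =>
    obtain ⟨rfl, hw⟩ := hw
    rw [List.forall_mem_cons] at hs
    rw [← sub_add_sub_cancel _ (α (stepEnd t hd st)), sub_eq_abs_slope_zsmul hα hs.1]
    rw [List.exists_mem_cons_iff] at hstrict
    obtain h | h := hstrict
    · have hne : s st.1 ≠ 0 := by
        obtain h | h := h
        · exact h.2.ne'
        · exact h.2.ne
      have hpos : 0 ≤ |s st.1| - 1 := Int.sub_nonneg_of_le (Int.one_le_abs hne)
      refine ⟨st.1, ?_⟩
      have := M.add_mem (hw.sub_mem hℓ hα hs.2) (zsmul_mem_of_nonneg (hℓ st.1) hpos)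
      rwa [sub_smul, one_smul, ← add_sub_assoc] at this
    · obtain ⟨e, he⟩ := ih hw hs.2 h
      refine ⟨e, ?_⟩
      rw [add_sub_right_comm]
      exact M.add_mem he (zsmul_mem_of_nonneg (hℓ _) (abs_nonneg _))

/-- If a flow `s` arises as the slopes of a piecewise linear function on a
tropical curve metrized by a sharp monoid `M` (edge lengths in `M \ {0}`),
then `s` is acyclic: there is no closed `s`-ascending walk. -/
theorem slopes_of_pl_function_acyclic
    {V E A : Type*} [AddCommGroup A] (M : AddSubmonoid A)
    (hM : ∀ x ∈ M, -x ∈ M → x = 0)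
    (t hd : E → V) (ℓ : E → A) (hℓ : ∀ e : E, ℓ e ∈ M ∧ ℓ e ≠ 0)
    (s : E → ℤ) (α : V → A)
    (hα : ∀ e : E, α (hd e) - α (t e) = s e • ℓ e) :
    ∀ (v : V) (l : List (E × Bool)), ¬ Ascending t hd s v v l := by
  intro v l hl
  obtain ⟨e, he⟩ := hl.exists_sub_sub_length_mem (fun e => (hℓ e).1) hα
  rw [sub_self, zero_sub] at he
  exact (hℓ e).2 (hM _ (hℓ e).1 he)
end

section
/- Let G be a finite multigraph with tail and head maps t, h : E → V, and let B : V → ℤ be a divisor. Then the set of acyclic flows s : E → ℤ with div(s) = B (that is, ∂s = B) is finite. -/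
theorem IsWalk.concat {V E : Type*} {t hd : E → V} {v w : V} {l : List (E × Bool)}
    (h : IsWalk t hd v w l) {st : E × Bool} (hst : stepStart t hd st = w) :
    IsWalk t hd v (stepEnd t hd st) (l ++ [st]) := by
  induction l generalizing v with
  | nil =>
    have hvw : v = w := h
    exact ⟨hst.trans hvw.symm, rfl⟩
  | cons a l ih => exact ⟨h.1, ih h.2⟩

theorem sum_boundary {V E : Type*} [Fintype E] [DecidableEq V] (t hd : E → V)
    (c : E → ℤ) (S : Finset V) :
    ∑ v ∈ S, boundary t hd c v =
      ∑ e, ((if hd e ∈ S then c e else 0) - (if t e ∈ S then c e else 0)) := by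
  simp only [boundary, Finset.sum_sub_distrib]
  rw [Finset.sum_comm, Finset.sum_comm (s := S)]
  simp

/-- The step `st` may occur in an `s`-ascending walk, strictness not being required of it. -/
def WeaklyAscendingStep {E : Type*} (s : E → ℤ) (st : E × Bool) : Prop :=
  (st.2 = true → 0 ≤ s st.1) ∧ (st.2 = false → s st.1 ≤ 0)

/-- The vertices reachable from `v` along steps that `s` allows. -/
def ascendingReach {V E : Type*} (t hd : E → V) (s : E → ℤ) (v : V) : Set V :=
  {w | ∃ l, IsWalk t hd v w l ∧ ∀ st ∈ l, WeaklyAscendingStep s st}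

theorem mem_ascendingReach_self {V E : Type*} (t hd : E → V) (s : E → ℤ) (v : V) :
    v ∈ ascendingReach t hd s v :=
  ⟨[], rfl, by simp⟩

theorem stepEnd_mem_ascendingReach {V E : Type*} {t hd : E → V} {s : E → ℤ} {v : V}
    {st : E × Bool} (hst : WeaklyAscendingStep s st)
    (h : stepStart t hd st ∈ ascendingReach t hd s v) :
    stepEnd t hd st ∈ ascendingReach t hd s v := by
  obtain ⟨l, hl, hl'⟩ := h
  refine ⟨l ++ [st], hl.concat rfl, fun a ha => ?_⟩
  rcases List.mem_append.mp ha with ha | ha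
  · exact hl' a ha
  · rwa [List.mem_singleton.mp ha]

theorem stepStart_notMem_ascendingReach {V E : Type*} {t hd : E → V} {s : E → ℤ}
    (hs : ∀ (v : V) (l : List (E × Bool)), ¬ Ascending t hd s v v l) {st : E × Bool}
    (hst : (st.2 = true ∧ 0 < s st.1) ∨ (st.2 = false ∧ s st.1 < 0)) :
    stepStart t hd st ∉ ascendingReach t hd s (stepEnd t hd st) := by
  rintro ⟨l, hl, hl'⟩
  refine hs (stepStart t hd st) (st :: l) ⟨⟨rfl, hl⟩, ?_, st, by simp, hst⟩
  intro a ha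
  rcases List.mem_cons.mp ha with rfl | ha
  · rcases hst with h | h <;> simp [h.1, h.2.le]
  · exact hl' a ha

/-- Along the set reachable from `v`, every edge contributes nonnegatively to the divisor. -/
theorem boundary_term_nonneg {V E : Type*} (t hd : E → V) (s : E → ℤ) (v : V)
    (S : Finset V) [DecidableEq V] (hS : ∀ w, w ∈ S ↔ w ∈ ascendingReach t hd s v) (e : E) :
    0 ≤ (if hd e ∈ S then s e else 0) - (if t e ∈ S then s e else 0) := by
  have hf : 0 ≤ s e → t e ∈ S → hd e ∈ S := fun h he => (hS _).2 <|
    stepEnd_mem_ascendingReach (st := (e, true)) ⟨fun _ => h, by simp⟩ ((hS _).1 he)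
  have hb : s e ≤ 0 → hd e ∈ S → t e ∈ S := fun h he => (hS _).2 <|
    stepEnd_mem_ascendingReach (st := (e, false)) ⟨by simp, fun _ => h⟩ ((hS _).1 he)
  grind

/-- An acyclic flow is bounded on every edge by the total absolute value of its divisor. -/
theorem abs_le_sum_abs_boundary {V E : Type*} [Fintype V] [Fintype E] [DecidableEq V]
    (t hd : E → V) (s : E → ℤ)
    (hs : ∀ (v : V) (l : List (E × Bool)), ¬ Ascending t hd s v v l) (e : E) :
    |s e| ≤ ∑ v, |boundary t hd s v| := by
  classical
  have main (b : Bool) (h : (b = true ∧ 0 < s e) ∨ (b = false ∧ s e < 0)) :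
      |s e| ≤ ∑ v, |boundary t hd s v| := by
    set r := ascendingReach t hd s (stepEnd t hd (e, b))
    set S : Finset V := Finset.univ.filter (· ∈ r)
    have hS (w : V) : w ∈ S ↔ w ∈ r := by simp [S]
    have hend : stepEnd t hd (e, b) ∈ S := (hS _).2 (mem_ascendingReach_self ..)
    have hstart : stepStart t hd (e, b) ∉ S := fun hm =>
      stepStart_notMem_ascendingReach hs (st := (e, b)) h ((hS _).1 hm)
    calc |s e| = (if hd e ∈ S then s e else 0) - (if t e ∈ S then s e else 0) := by
          rcases h with ⟨rfl, h⟩ | ⟨rfl, h⟩ <;> simp only [stepEnd, stepStart] at hend hstart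
          · simp_all [abs_of_pos h]
          · simp_all [abs_of_neg h]
      _ ≤ ∑ e, ((if hd e ∈ S then s e else 0) - (if t e ∈ S then s e else 0)) :=
          Finset.single_le_sum (f := fun e =>
            (if hd e ∈ S then s e else 0) - (if t e ∈ S then s e else 0))
            (fun a _ => boundary_term_nonneg t hd s _ S hS a) (Finset.mem_univ e)
      _ = ∑ v ∈ S, boundary t hd s v := (sum_boundary t hd s S).symm
      _ ≤ ∑ v ∈ S, |boundary t hd s v| := Finset.sum_le_sum fun _ _ => le_abs_self _
      _ ≤ ∑ v, |boundary t hd s v| :=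
          Finset.sum_le_sum_of_subset_of_nonneg (Finset.subset_univ S) fun _ _ _ => abs_nonneg _
  rcases lt_trichotomy (s e) 0 with h | h | h
  · exact main false (.inr ⟨rfl, h⟩)
  · rw [h, abs_zero]
    exact Finset.sum_nonneg fun _ _ => abs_nonneg _
  · exact main true (.inl ⟨rfl, h⟩)

/-- On a finite multigraph, for a fixed divisor `B` there are only finitely
many acyclic flows `s` with `div(s) = B`. -/
theorem acyclic_flows_with_fixed_divisor_finite
    {V E : Type*} [Fintype V] [Fintype E] [DecidableEq V]
    (t hd : E → V) (B : V → ℤ) :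
    Set.Finite {s : E → ℤ | boundary t hd s = B ∧
      ∀ (v : V) (l : List (E × Bool)), ¬ Ascending t hd s v v l} := by
  classical
  refine (Set.finite_Icc (fun _ : E => -∑ v, |B v|) (fun _ => ∑ v, |B v|)).subset ?_
  rintro s ⟨hB, hs⟩
  have key (e : E) : |s e| ≤ ∑ v, |B v| := by
    rw [← hB]
    exact abs_le_sum_abs_boundary t hd s hs e
  exact ⟨fun e => (abs_le.mp (key e)).1, fun e => (abs_le.mp (key e)).2⟩
end

section
/- Let E and F be finite sets, E_c ⊆ E a subset, φ : E \ E_c → F a surjection, and s : E \ E_c → ℤ a function with s(e) ≥ 1 for all e. Then the submonoid N = {(x, y) ∈ ℕ^E × ℕ^F : s(e)·x(e) = y(φ(e)) for all e ∈ E \ E_c} of ℕ^E × ℕ^F is a free commutative monoid of rank |E_c| + |F|. Explicitly, N is freely generated by: the unit vectors 1_e for e ∈ E_c, and for each f ∈ F the element whose y-coordinate is L_f·1_f and whose x-coordinate assigns L_f / s(e) to each e with φ(e) = f and 0 to all other edges, where L_f = lcm{ s(e) : φ(e) = f }. -/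
/-- The monoid `N ⊆ ℕ^E × ℕ^F` of integral points of the cone cut out by the
equations `s(e)·x(e) = y(φ(e))` for the non-contracted edges `e ∉ E_c`. -/
def rubMonoid {E F : Type*} (Ec : Set E)
    (φ : {e : E // e ∉ Ec} → F) (s : {e : E // e ∉ Ec} → ℤ) :
    AddSubmonoid ((E → ℕ) × (F → ℕ)) where
  carrier := {p | ∀ e : {e : E // e ∉ Ec}, s e * (p.1 e : ℤ) = (p.2 (φ e) : ℤ)}
  zero_mem' := by intro e; simp
  add_mem' := by
    intro a b ha hb e
    have h1 := ha e
    have h2 := hb e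
    simp only [Prod.fst_add, Prod.snd_add, Pi.add_apply] at *
    push_cast
    rw [mul_add, h1, h2]

/-- `lcmSlope Ec φ s f = L_f`, the lcm of the slopes `s(e)` over the edges `e`
with `φ(e) = f`. -/
def lcmSlope {E F : Type*} [Fintype E] [DecidableEq F] (Ec : Set E)
    [DecidablePred (· ∈ Ec)]
    (φ : {e : E // e ∉ Ec} → F) (s : {e : E // e ∉ Ec} → ℤ) (f : F) : ℕ :=
  Finset.lcm (Finset.univ.filter fun e : {e : E // e ∉ Ec} => φ e = f)
    (fun e => (s e).toNat)

/-- The generator of `N` attached to a contracted edge `e₀ ∈ E_c`: the unit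
vector `1_{e₀}`. -/
def genContr {E F : Type*} [DecidableEq E] (Ec : Set E)
    (e₀ : {e : E // e ∈ Ec}) : (E → ℕ) × (F → ℕ) :=
  (Pi.single (e₀ : E) 1, 0)

/-- The generator of `N` attached to `f ∈ F`: `y`-coordinate `L_f·1_f`, and
`x`-coordinate `L_f / s(e)` on each non-contracted edge `e` with `φ(e) = f`,
zero elsewhere. -/
def genEdge {E F : Type*} [Fintype E] [DecidableEq F] (Ec : Set E)
    [DecidablePred (· ∈ Ec)]
    (φ : {e : E // e ∉ Ec} → F) (s : {e : E // e ∉ Ec} → ℤ) (f : F) :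
    (E → ℕ) × (F → ℕ) :=
  ((fun e => if he : e ∉ Ec then
      (if φ ⟨e, he⟩ = f then lcmSlope Ec φ s f / (s ⟨e, he⟩).toNat else 0)
    else 0),
   Pi.single f (lcmSlope Ec φ s f))

theorem mem_rubMonoid_iff {E F : Type*} {Ec : Set E} {φ : {e : E // e ∉ Ec} → F}
    {s : {e : E // e ∉ Ec} → ℤ} (hs : ∀ e, 1 ≤ s e) {p : (E → ℕ) × (F → ℕ)} :
    p ∈ rubMonoid Ec φ s ↔ ∀ e, (s e).toNat * p.1 e = p.2 (φ e) := by
  refine forall_congr' fun e => ?_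
  rw [← Nat.cast_inj (R := ℤ), Nat.cast_mul, Int.toNat_of_nonneg (by linarith [hs e])]

section Slopes

variable {E F : Type*} [Fintype E] [DecidableEq F] {Ec : Set E} [DecidablePred (· ∈ Ec)]
  {φ : {e : E // e ∉ Ec} → F} {s : {e : E // e ∉ Ec} → ℤ}

theorem toNat_dvd_lcmSlope (e : {e : E // e ∉ Ec}) :
    (s e).toNat ∣ lcmSlope Ec φ s (φ e) :=
  Finset.dvd_lcm (by simp)

theorem lcmSlope_pos (hs : ∀ e, 1 ≤ s e) (f : F) : 0 < lcmSlope Ec φ s f := by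
  refine Nat.pos_of_ne_zero fun h => ?_
  obtain ⟨e, -, he⟩ := Finset.lcm_eq_zero_iff.mp h
  have := hs e
  omega

theorem lcmSlope_dvd_of_mem_rubMonoid (hs : ∀ e, 1 ≤ s e) {p : (E → ℕ) × (F → ℕ)}
    (hp : p ∈ rubMonoid Ec φ s) (f : F) : lcmSlope Ec φ s f ∣ p.2 f := by
  refine Finset.lcm_dvd fun e he => ?_
  obtain rfl := (Finset.mem_filter.mp he).2
  exact ⟨_, ((mem_rubMonoid_iff hs).mp hp e).symm⟩

variable (φ s) in
theorem sum_genContr_add_sum_genEdge [Fintype F] [DecidableEq E]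
    (a : {e : E // e ∈ Ec} → ℕ) (b : F → ℕ) :
    (∑ e₀, a e₀ • genContr (F := F) Ec e₀) + (∑ f, b f • genEdge Ec φ s f) =
      (fun e => if he : e ∈ Ec then a ⟨e, he⟩
        else b (φ ⟨e, he⟩) * (lcmSlope Ec φ s (φ ⟨e, he⟩) / (s ⟨e, he⟩).toNat),
       fun f => b f * lcmSlope Ec φ s f) := by
  ext i
  · by_cases hi : i ∈ Ec
    · have h : ∀ x : {e : E // e ∈ Ec}, i = x ↔ (⟨i, hi⟩ : {e : E // e ∈ Ec}) = x :=
        fun x => by rw [Subtype.ext_iff]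
      simp [Prod.fst_sum, Finset.sum_apply, genContr, genEdge, hi, Pi.single_apply, h]
    · have h : ∀ x : {e : E // e ∈ Ec}, i ≠ x := fun x hx => hi (hx ▸ x.2)
      simp [Prod.fst_sum, Finset.sum_apply, genContr, genEdge, hi, h]
  · simp [Prod.snd_sum, Finset.sum_apply, genContr, genEdge, Pi.single_apply]

end Slopes

/-- The monoid `N = {(x,y) ∈ ℕ^E × ℕ^F : s(e)·x(e) = y(φ(e)) for e ∉ E_c}` is a
free commutative monoid of rank `|E_c| + |F|`, freely generated by the unit
vectors `1_e` for the contracted edges `e ∈ E_c` together with, for each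
`f ∈ F`, the element with `y`-coordinate `L_f·1_f` and `x`-coordinate
`L_f / s(e)` on the edges `e` with `φ(e) = f`, where
`L_f = lcm{s(e) : φ(e) = f}`: these elements lie in `N`, and every element of
`N` is a unique `ℕ`-linear combination of them. -/
theorem rubMonoid_free_of_rank
    {E F : Type*} [Fintype E] [Fintype F] [DecidableEq E] [DecidableEq F]
    (Ec : Set E) [DecidablePred (· ∈ Ec)]
    (φ : {e : E // e ∉ Ec} → F) (hφ : Function.Surjective φ)
    (s : {e : E // e ∉ Ec} → ℤ) (hs : ∀ e, 1 ≤ s e) :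
    (∀ e₀ : {e : E // e ∈ Ec}, genContr (F := F) Ec e₀ ∈ rubMonoid Ec φ s) ∧
    (∀ f : F, genEdge Ec φ s f ∈ rubMonoid Ec φ s) ∧
    (∀ p ∈ rubMonoid Ec φ s,
      ∃! ab : ({e : E // e ∈ Ec} → ℕ) × (F → ℕ),
        p = (∑ e₀, ab.1 e₀ • genContr (F := F) Ec e₀) +
            (∑ f, ab.2 f • genEdge Ec φ s f)) := by
  refine ⟨fun e₀ => (mem_rubMonoid_iff hs).mpr fun e => ?_,
    fun f => (mem_rubMonoid_iff hs).mpr fun e => ?_, fun p hp => ?_⟩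
  · have h : (e : E) ≠ e₀ := fun h => e.2 (h ▸ e₀.2)
    simp [genContr, h]
  · by_cases h : φ e = f
    · subst h
      simp [genEdge, e.2, Nat.mul_div_cancel' (toNat_dvd_lcmSlope e)]
    · simp [genEdge, e.2, h]
  · have hL := lcmSlope_dvd_of_mem_rubMonoid hs hp
    refine ⟨(fun e => p.1 e, fun f => p.2 f / lcmSlope Ec φ s f), ?_, ?_⟩
    · dsimp only
      rw [sum_genContr_add_sum_genEdge]
      ext i
      · by_cases hi : i ∈ Ec
        · simp [hi]
        · have hpos : 0 < (s ⟨i, hi⟩).toNat := by have := hs ⟨i, hi⟩; omega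
          simp only [hi, dite_false]
          rw [← Nat.mul_div_assoc _ (toNat_dvd_lcmSlope _), Nat.div_mul_cancel (hL _),
            ← (mem_rubMonoid_iff hs).mp hp ⟨i, hi⟩, Nat.mul_div_cancel_left _ hpos]
      · exact (Nat.div_mul_cancel (hL _)).symm
    · rintro ⟨a, b⟩ h
      dsimp only at h
      rw [sum_genContr_add_sum_genEdge] at h
      subst h
      ext i
      · simp [i.2]
      · exact (Nat.mul_div_cancel _ (lcmSlope_pos hs i)).symm
end
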